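/- (Recovery of thermodynamic channels) With the setup of the thermodynamic channel — Hermitian H_S, H'_S, H_B, H'_B, β > 0, unitary U with U(H_S⊗1 + 1⊗H_B)U† = H'_S⊗1 + 1⊗H'_B, Gibbs states γ_S = e^{−βH_S}/Z_S, γ'_S = e^{−βH'_S}/Z'_S, γ_B = e^{−βH_B}/Tr[e^{−βH_B}], channel N_th(ρ) = Tr_B[U(ρ⊗γ_B)U†], and Petz recovery map R_{γ_S} of N_th with reference γ_S — let ρ be a positive-definite system density matrix with N_th(ρ) positive definite. Define the nonequilibrium free energies F(τ, H) = Tr[τH] − β^{−1} S(τ) (with S the von Neumann entropy, k_B = 1), ΔF = F(N_th(ρ), H'_S) − F(ρ, H_S), and ΔF_eq = β^{−1} log(Z_S/Z'_S). Then ΔF ≤ ΔF_eq, and the recovery fidelity is bounded below as F(ρ, (R_{γ_S} ∘ N_th)(ρ)) ≥ exp(β(ΔF − ΔF_eq)); in particular ρ is fully recovered by R_{γ_S} if and only if ΔF = ΔF_eq. -/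

import Mathlib

open Matrix
open scoped ComplexOrder Kronecker

/-- Functional calculus of a Hermitian matrix, via its spectral decomposition
(junk value `0` on non-Hermitian matrices). -/
noncomputable def mfun {n : Type} [Fintype n] [DecidableEq n] (f : ℝ → ℂ)
    (M : Matrix n n ℂ) : Matrix n n ℂ :=
  if h : M.IsHermitian then
    (h.eigenvectorUnitary : Matrix n n ℂ) *
      Matrix.diagonal (fun i => f (h.eigenvalues i)) *
      star (h.eigenvectorUnitary : Matrix n n ℂ)
  else 0

/-- Complex matrix power A^z = exp (z log A) of a positive-definite matrix,
defined via its spectral decomposition. -/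
noncomputable def mpow {n : Type} [Fintype n] [DecidableEq n]
    (M : Matrix n n ℂ) (z : ℂ) : Matrix n n ℂ :=
  mfun (fun r => (r : ℂ) ^ z) M

/-- The matrix exponential e^{−βH} of (−β times) a Hermitian matrix, via spectral
decomposition. -/
noncomputable def mexpNeg {n : Type} [Fintype n] [DecidableEq n] (β : ℝ)
    (H : Matrix n n ℂ) : Matrix n n ℂ :=
  mfun (fun r => (Real.exp (-β * r) : ℂ)) H

/-- The Gibbs state e^{−βH}/Tr[e^{−βH}]. -/
noncomputable def gibbs {n : Type} [Fintype n] [DecidableEq n] (β : ℝ)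
    (H : Matrix n n ℂ) : Matrix n n ℂ :=
  ((mexpNeg β H).trace)⁻¹ • mexpNeg β H

/-- Partial trace over the bath (second) factor. -/
noncomputable def ptraceB {dS dB : ℕ} (M : Matrix (Fin dS × Fin dB) (Fin dS × Fin dB) ℂ) :
    Matrix (Fin dS) (Fin dS) ℂ :=
  Matrix.of fun i j => ∑ b, M (i, b) (j, b)

/-- The thermodynamic channel N_th(ρ) = Tr_B[U(ρ ⊗ γ_B)U†]. -/
noncomputable def thChannel {dS dB : ℕ} (U : Matrix (Fin dS × Fin dB) (Fin dS × Fin dB) ℂ)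
    (γB : Matrix (Fin dB) (Fin dB) ℂ) (ρ : Matrix (Fin dS) (Fin dS) ℂ) :
    Matrix (Fin dS) (Fin dS) ℂ :=
  ptraceB (U * (ρ ⊗ₖ γB) * Uᴴ)

/-- The Petz recovery map R_γ(X) = γ^{1/2} N†(N(γ)^{-1/2} X N(γ)^{-1/2}) γ^{1/2} of a channel
with adjoint map `Nadj`, reference state `γ` and output reference state `Nγ`. -/
noncomputable def petzOf {n : Type} [Fintype n] [DecidableEq n]
    (Nadj : Matrix n n ℂ → Matrix n n ℂ) (γ Nγ : Matrix n n ℂ) (X : Matrix n n ℂ) :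
    Matrix n n ℂ :=
  mpow γ (1/2) * Nadj (mpow Nγ (-(1/2)) * X * mpow Nγ (-(1/2))) * mpow γ (1/2)

/-- The matrix logarithm of a positive-definite matrix, via spectral decomposition. -/
noncomputable def mlog {n : Type} [Fintype n] [DecidableEq n] (M : Matrix n n ℂ) :
    Matrix n n ℂ :=
  mfun (fun r => (Real.log r : ℂ)) M

/-- The matrix square root of a positive-semidefinite matrix, via spectral decomposition. -/
noncomputable def msqrt {n : Type} [Fintype n] [DecidableEq n] (M : Matrix n n ℂ) :
    Matrix n n ℂ :=
  mfun (fun r => (Real.sqrt r : ℂ)) M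

/-- The quantum fidelity F(A,B) = (Tr[√(√A B √A)])². -/
noncomputable def fid {n : Type} [Fintype n] [DecidableEq n] (A B : Matrix n n ℂ) : ℝ :=
  (((msqrt (msqrt A * B * msqrt A)).trace).re) ^ 2

/-- The von Neumann entropy S(τ) = −Tr[τ log τ]. -/
noncomputable def vonNeumann {n : Type} [Fintype n] [DecidableEq n] (τ : Matrix n n ℂ) : ℝ :=
  -(((τ * mlog τ).trace).re)

/-- The nonequilibrium free energy F(τ, H) = Tr[τH] − β⁻¹ S(τ) (k_B = 1). -/
noncomputable def freeEnergy {n : Type} [Fintype n] [DecidableEq n] (β : ℝ)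
    (τ H : Matrix n n ℂ) : ℝ :=
  ((τ * H).trace).re - β⁻¹ * vonNeumann τ

/-- The partition function Z = Tr[e^{−βH}]. -/
noncomputable def partZ {n : Type} [Fintype n] [DecidableEq n] (β : ℝ)
    (H : Matrix n n ℂ) : ℝ :=
  ((mexpNeg β H).trace).re

/-- `V` unitarily diagonalizes `M` with real diagonal `d`. -/
def Dg {n : Type} [Fintype n] [DecidableEq n] (M V : Matrix n n ℂ) (d : n → ℝ) : Prop :=
  V * Vᴴ = 1 ∧ Vᴴ * V = 1 ∧ M = V * diagonal (fun i => (d i : ℂ)) * Vᴴ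

section basic
variable {n m : Type} [Fintype n] [DecidableEq n] [Fintype m] [DecidableEq m]

lemma mfun_spec {M : Matrix n n ℂ} (h : M.IsHermitian) (f : ℝ → ℂ) :
    ∃ V : Matrix n n ℂ, Dg M V h.eigenvalues ∧
      mfun f M = V * diagonal (fun i => f (h.eigenvalues i)) * Vᴴ := by
  refine ⟨(h.eigenvectorUnitary : Matrix n n ℂ), ⟨?_, ?_, ?_⟩, ?_⟩
  · have := Unitary.coe_mul_star_self h.eigenvectorUnitary
    simpa [star_eq_conjTranspose] using this
  · have := Unitary.coe_star_mul_self h.eigenvectorUnitary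
    simpa [star_eq_conjTranspose] using this
  · have := h.spectral_theorem
    rw [Unitary.conjStarAlgAut_apply] at this
    exact this
  · unfold mfun
    rw [dif_pos h]
    rfl

lemma Dg.herm {M V : Matrix n n ℂ} {d : n → ℝ} (h : Dg M V d) : M.IsHermitian := by
  rw [h.2.2]
  unfold IsHermitian
  simp [conjTranspose_mul, Matrix.mul_assoc, diagonal_conjTranspose]
  congr 3
  ext i
  simp

lemma exists_Dg {M : Matrix n n ℂ} (h : M.IsHermitian) : ∃ V d, Dg M V d := by
  obtain ⟨V, hV, -⟩ := mfun_spec h (fun _ => 0)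
  exact ⟨V, _, hV⟩

lemma Dg.mfun {M V : Matrix n n ℂ} {d : n → ℝ} (h : Dg M V d) (f : ℝ → ℂ) :
    mfun f M = V * diagonal (fun i => f (d i)) * Vᴴ := by
  obtain ⟨W, ⟨hW1, hW2, hW3⟩, hf⟩ := mfun_spec h.herm f
  obtain ⟨hV1, hV2, hV3⟩ := h
  set e := (Dg.herm ⟨hV1, hV2, hV3⟩ : M.IsHermitian).eigenvalues with he
  clear_value e
  rw [hf]
  have h1 : (Wᴴ * V) * diagonal (fun i => (d i : ℂ)) =
      diagonal (fun i => (e i : ℂ)) * (Wᴴ * V) := by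
    calc _ = Wᴴ * (V * diagonal (fun i => (d i : ℂ)) * Vᴴ) * V := by
          simp only [Matrix.mul_assoc, hV2, Matrix.mul_one]
      _ = Wᴴ * (W * diagonal (fun i => (e i : ℂ)) * Wᴴ) * V := by rw [← hV3, ← hW3]
      _ = (Wᴴ * W) * diagonal (fun i => (e i : ℂ)) * (Wᴴ * V) := by
          simp only [Matrix.mul_assoc]
      _ = _ := by rw [hW2, Matrix.one_mul]
  have h2 : (Wᴴ * V) * diagonal (fun i => f (d i)) =
      diagonal (fun i => f (e i)) * (Wᴴ * V) := by
    ext i j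
    have := congrFun (congrFun h1 i) j
    rw [mul_diagonal, diagonal_mul] at this ⊢
    by_cases hz : (Wᴴ * V) i j = 0
    · simp [hz]
    · have : (d j : ℂ) = e i := by
        have h3 : (Wᴴ * V) i j * ((d j : ℂ) - e i) = 0 := by linear_combination this
        have := (mul_eq_zero.mp h3).resolve_left hz
        linear_combination this
      have : d j = e i := by exact_mod_cast this
      rw [this, mul_comm]
  calc W * diagonal (fun i => f (e i)) * Wᴴ
      = W * (diagonal (fun i => f (e i)) * (Wᴴ * V)) * Vᴴ := by
        simp only [Matrix.mul_assoc, hV1, Matrix.mul_one]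
    _ = (W * Wᴴ) * V * diagonal (fun i => f (d i)) * Vᴴ := by
        rw [← h2]; simp only [Matrix.mul_assoc]
    _ = _ := by rw [hW1, Matrix.one_mul]

lemma Dg.mfunR {M V : Matrix n n ℂ} {d : n → ℝ} (h : Dg M V d) {f : ℝ → ℂ} {g : n → ℝ}
    (hg : ∀ i, f (d i) = g i) : Dg (_root_.mfun f M) V g := by
  refine ⟨h.1, h.2.1, ?_⟩
  rw [h.mfun]
  simp only [hg]

lemma Dg.conj {M V : Matrix n n ℂ} {d : n → ℝ} (h : Dg M V d) {U : Matrix n n ℂ}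
    (h1 : U * Uᴴ = 1) (h2 : Uᴴ * U = 1) : Dg (U * M * Uᴴ) (U * V) d := by
  obtain ⟨hV1, hV2, hV3⟩ := h
  refine ⟨?_, ?_, ?_⟩
  · rw [conjTranspose_mul, Matrix.mul_assoc, ← Matrix.mul_assoc V, hV1, Matrix.one_mul, h1]
  · rw [conjTranspose_mul, Matrix.mul_assoc, ← Matrix.mul_assoc Uᴴ, h2, Matrix.one_mul, hV2]
  · rw [hV3, conjTranspose_mul]; simp only [Matrix.mul_assoc]

lemma Dg.smul {M V : Matrix n n ℂ} {d : n → ℝ} (h : Dg M V d) (c : ℝ) :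
    Dg ((c : ℂ) • M) V (fun i => c * d i) := by
  obtain ⟨hV1, hV2, hV3⟩ := h
  refine ⟨hV1, hV2, ?_⟩
  have : diagonal (fun i => ((c * d i : ℝ) : ℂ)) = (c : ℂ) • diagonal (fun i => (d i : ℂ)) := by
    ext i j; by_cases hij : i = j
    · subst hij; simp
    · simp [hij]
  rw [this, hV3, Matrix.mul_smul, Matrix.smul_mul]

lemma Dg.one_add {M V : Matrix n n ℂ} {d : n → ℝ} (h : Dg M V d) (c e : ℝ) :
    Dg ((c : ℂ) • M + (e : ℂ) • 1) V (fun i => c * d i + e) := by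
  obtain ⟨hV1, hV2, hV3⟩ := h
  refine ⟨hV1, hV2, ?_⟩
  have : diagonal (fun i => ((c * d i + e : ℝ) : ℂ)) =
      (c : ℂ) • diagonal (fun i => (d i : ℂ)) + (e : ℂ) • 1 := by
    ext i j; by_cases hij : i = j
    · subst hij; simp
    · simp [hij]
  rw [this, Matrix.mul_add, Matrix.add_mul, hV3, Matrix.mul_smul, Matrix.smul_mul,
    Matrix.mul_smul, Matrix.mul_one, Matrix.smul_mul, hV1]

/-- two matrices diagonalized by the same unitary with the same diagonal agree -/
lemma Dg.eq {M N V : Matrix n n ℂ} {d e : n → ℝ} (h : Dg M V d) (h' : Dg N V e)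
    (hde : ∀ i, d i = e i) : M = N := by
  rw [h.2.2, h'.2.2]; simp only [hde]

lemma Dg.kron {M V : Matrix n n ℂ} {d : n → ℝ} (h : Dg M V d)
    {N W : Matrix m m ℂ} {e : m → ℝ} (h' : Dg N W e) :
    Dg (M ⊗ₖ N) (V ⊗ₖ W) (fun p => d p.1 * e p.2) := by
  obtain ⟨hV1, hV2, hV3⟩ := h
  obtain ⟨hW1, hW2, hW3⟩ := h'
  refine ⟨?_, ?_, ?_⟩
  · rw [conjTranspose_kronecker, ← mul_kronecker_mul, hV1, hW1, one_kronecker_one]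
  · rw [conjTranspose_kronecker, ← mul_kronecker_mul, hV2, hW2, one_kronecker_one]
  · have : diagonal (fun p : n × m => ((d p.1 * e p.2 : ℝ) : ℂ)) =
      diagonal (fun i => (d i : ℂ)) ⊗ₖ diagonal (fun i => (e i : ℂ)) := by
      rw [diagonal_kronecker_diagonal]; simp
    rw [this, conjTranspose_kronecker, ← mul_kronecker_mul, ← mul_kronecker_mul, hV3, hW3]

lemma Dg.kron_add {M V : Matrix n n ℂ} {d : n → ℝ} (h : Dg M V d)
    {N W : Matrix m m ℂ} {e : m → ℝ} (h' : Dg N W e) :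
    Dg (M ⊗ₖ (1 : Matrix m m ℂ) + (1 : Matrix n n ℂ) ⊗ₖ N) (V ⊗ₖ W)
      (fun p => d p.1 + e p.2) := by
  obtain ⟨hV1, hV2, hV3⟩ := h
  obtain ⟨hW1, hW2, hW3⟩ := h'
  refine ⟨?_, ?_, ?_⟩
  · rw [conjTranspose_kronecker, ← mul_kronecker_mul, hV1, hW1, one_kronecker_one]
  · rw [conjTranspose_kronecker, ← mul_kronecker_mul, hV2, hW2, one_kronecker_one]
  · have : diagonal (fun p : n × m => ((d p.1 + e p.2 : ℝ) : ℂ)) =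
      diagonal (fun i => (d i : ℂ)) ⊗ₖ (1 : Matrix m m ℂ) +
      (1 : Matrix n n ℂ) ⊗ₖ diagonal (fun i => (e i : ℂ)) := by
      rw [← diagonal_one, ← diagonal_one, diagonal_kronecker_diagonal,
        diagonal_kronecker_diagonal, diagonal_add]; simp
    rw [this, conjTranspose_kronecker, Matrix.mul_add, Matrix.add_mul,
      ← mul_kronecker_mul, ← mul_kronecker_mul, ← mul_kronecker_mul, ← mul_kronecker_mul,
      Matrix.mul_one, Matrix.mul_one, hV1, hW1, hV3, hW3]

lemma Dg.posDef {M V : Matrix n n ℂ} {d : n → ℝ} (h : Dg M V d) (hd : ∀ i, 0 < d i) :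
    M.PosDef := by
  have hU : IsUnit V := ⟨⟨V, Vᴴ, h.1, h.2.1⟩, rfl⟩
  have := (Matrix.IsUnit.posDef_star_right_conjugate_iff (U := V)
    (x := diagonal (fun i => (d i : ℂ))) hU).2
    (PosDef.diagonal (fun i => by exact_mod_cast hd i))
  rw [h.2.2]
  exact this

lemma exists_Dg_pos {M : Matrix n n ℂ} (h : M.PosDef) : ∃ V d, Dg M V d ∧ ∀ i, 0 < d i := by
  obtain ⟨V, hV, -⟩ := mfun_spec h.isHermitian (fun _ => 0)
  exact ⟨V, _, hV, h.eigenvalues_pos⟩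

lemma msqrt_posDef {M : Matrix n n ℂ} (h : M.PosDef) :
    (msqrt M).PosDef ∧ msqrt M * msqrt M = M := by
  obtain ⟨V, d, hV, hd⟩ := exists_Dg_pos h
  have h1 : Dg (msqrt M) V (fun i => Real.sqrt (d i)) := hV.mfunR (fun i => rfl)
  refine ⟨h1.posDef (fun i => Real.sqrt_pos.2 (hd i)), ?_⟩
  rw [h1.2.2]
  calc _ = V * (diagonal (fun i => (Real.sqrt (d i) : ℂ)) * (Vᴴ * V) *
        diagonal (fun i => (Real.sqrt (d i) : ℂ))) * Vᴴ := by simp only [Matrix.mul_assoc]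
    _ = M := by
      rw [hV.2.1, Matrix.mul_one, diagonal_mul_diagonal]
      conv_rhs => rw [hV.2.2]
      congr 3
      ext i
      rw [← Complex.ofReal_mul, Real.mul_self_sqrt (hd i).le]

lemma Dg.trace {M V : Matrix n n ℂ} {d : n → ℝ} (h : Dg M V d) :
    M.trace = ((∑ i, d i : ℝ) : ℂ) := by
  rw [h.2.2, Matrix.trace_mul_comm, ← Matrix.mul_assoc, h.2.1, Matrix.one_mul, trace_diagonal]
  simp

/-- trace of a product in two eigenbases -/
lemma trace_two {A V B W : Matrix n n ℂ} {a b : n → ℝ} (hA : Dg A V a) (hB : Dg B W b) :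
    (A * B).trace = ((∑ i, ∑ j, a i * b j * Complex.normSq ((Vᴴ * W) i j) : ℝ) : ℂ) := by
  have h1 : (A * B).trace = (diagonal (fun i => (a i : ℂ)) * (Vᴴ * W) *
      diagonal (fun i => (b i : ℂ)) * (Vᴴ * W)ᴴ).trace := by
    rw [hA.2.2, hB.2.2, Matrix.mul_assoc, Matrix.mul_assoc, Matrix.trace_mul_comm]
    simp only [Matrix.mul_assoc, conjTranspose_mul, conjTranspose_conjTranspose]
  rw [h1]
  simp only [Matrix.trace, Matrix.diag, Matrix.mul_apply (N := (Vᴴ * W)ᴴ), mul_diagonal,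
    diagonal_mul, conjTranspose_apply, Complex.ofReal_sum, Complex.ofReal_mul]
  refine Finset.sum_congr rfl fun i _ => Finset.sum_congr rfl fun j _ => ?_
  rw [Complex.normSq_eq_conj_mul_self]
  simp only [RCLike.star_def]
  ring

lemma row_sum {V W A B : Matrix n n ℂ} {a b : n → ℝ} (hA : Dg A V a) (hB : Dg B W b) (i : n) :
    ∑ j, Complex.normSq ((Vᴴ * W) i j) = 1 := by
  have h1 : (Vᴴ * W) * (Vᴴ * W)ᴴ = 1 := by
    rw [conjTranspose_mul, conjTranspose_conjTranspose, Matrix.mul_assoc, ← Matrix.mul_assoc W,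
      hB.1, Matrix.one_mul, hA.2.1]
  have := congrFun (congrFun h1 i) i
  rw [Matrix.mul_apply, Matrix.one_apply_eq] at this
  have h2 : ((∑ j, Complex.normSq ((Vᴴ * W) i j) : ℝ) : ℂ) = 1 := by
    rw [← this, Complex.ofReal_sum]
    refine Finset.sum_congr rfl fun j _ => ?_
    rw [Complex.normSq_eq_conj_mul_self, conjTranspose_apply, mul_comm]; rfl
  exact_mod_cast h2

/-- `-log F ≤ D`, in exponential form. -/
lemma jensen {A B : Matrix n n ℂ} (hA : A.PosDef) (hB : B.PosDef) (htr : A.trace = 1) :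
    Real.exp ((1/2) * ((A * mlog B).trace.re - (A * mlog A).trace.re)) ≤
      (msqrt A * msqrt B).trace.re := by
  obtain ⟨V, a, hV, ha⟩ := exists_Dg_pos hA
  obtain ⟨W, b, hW, hb⟩ := exists_Dg_pos hB
  have hsA : Dg (msqrt A) V (fun i => Real.sqrt (a i)) := hV.mfunR (fun i => rfl)
  have hsB : Dg (msqrt B) W (fun i => Real.sqrt (b i)) := hW.mfunR (fun i => rfl)
  have hlA : Dg (mlog A) V (fun i => Real.log (a i)) := hV.mfunR (fun i => rfl)
  have hlB : Dg (mlog B) W (fun i => Real.log (b i)) := hW.mfunR (fun i => rfl)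
  have hrow := row_sum hV hW
  rw [trace_two hV hlB, trace_two hV hlA, trace_two hsA hsB]
  set q := fun i j => Complex.normSq ((Vᴴ * W) i j) with hq
  have hq0 : ∀ i j, 0 ≤ q i j := fun i j => Complex.normSq_nonneg _
  have hVV : ∀ i, ∑ j, a i * Real.log (a j) * Complex.normSq ((Vᴴ * V) i j) =
      a i * Real.log (a i) := by
    intro i
    rw [hV.2.1, Finset.sum_eq_single i]
    · simp
    · intro j _ hj; simp [Matrix.one_apply_ne hj.symm]
    · simp
  simp only [Complex.ofReal_re, hVV]
  have hsum : ∑ i, a i = 1 := by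
    have := hV.trace; rw [htr] at this; exact_mod_cast this.symm
  have key := convexOn_exp.map_sum_le (t := (Finset.univ : Finset (n × n)))
    (w := fun p => a p.1 * q p.1 p.2)
    (p := fun p => (1/2) * (Real.log (b p.2) - Real.log (a p.1)))
    (fun p _ => mul_nonneg (ha _).le (hq0 _ _))
    (by rw [Fintype.sum_prod_type]; simp only [← Finset.mul_sum]
        simp only [hq, hrow, mul_one, hsum]) (fun _ _ => Set.mem_univ _)
  simp only [smul_eq_mul, Fintype.sum_prod_type] at key
  refine le_trans (le_of_eq ?_) (key.trans (le_of_eq ?_))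
  · congr 1
    rw [← Finset.sum_sub_distrib, Finset.mul_sum]
    refine Finset.sum_congr rfl fun i _ => ?_
    have : a i * Real.log (a i) = ∑ j, a i * Real.log (a i) * q i j := by
      rw [← Finset.mul_sum]; simp only [hq, hrow, mul_one]
    rw [this, ← Finset.sum_sub_distrib, Finset.mul_sum]
    exact Finset.sum_congr rfl fun j _ => by ring
  · refine Finset.sum_congr rfl fun i _ => Finset.sum_congr rfl fun j _ => ?_
    have h1 : Real.exp (1/2 * (Real.log (b j) - Real.log (a i))) =
        Real.sqrt (b j) / Real.sqrt (a i) := by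
      rw [show (1:ℝ)/2 * (Real.log (b j) - Real.log (a i)) = Real.log (b j) / 2 - Real.log (a i) / 2 by ring, Real.exp_sub, ← Real.log_sqrt (hb j).le]
      rw [← Real.log_sqrt (ha i).le, Real.exp_log (Real.sqrt_pos.2 (hb j)),
        Real.exp_log (Real.sqrt_pos.2 (ha i))]
    rw [h1]
    have h2 := Real.mul_self_sqrt (ha i).le
    have h3 := (Real.sqrt_pos.2 (ha i)).ne'
    field_simp
    rw [pow_two, h2]
    simp only [hq]
    ring

end basic

section fidelity
variable {n m : Type} [Fintype n] [DecidableEq n] [Fintype m] [DecidableEq m]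

lemma trace_sq_nonneg (M : Matrix n n ℂ) : 0 ≤ (Mᴴ * M).trace.re := by
  have := (posSemidef_conjTranspose_mul_self M).trace_nonneg
  exact (Complex.le_def.1 this).1

lemma PosDef.inv_mul {M : Matrix n n ℂ} (h : M.PosDef) : M⁻¹ * M = 1 :=
  Matrix.nonsing_inv_mul _ ((Matrix.isUnit_iff_isUnit_det _).1 h.isUnit)

lemma PosDef.mul_inv {M : Matrix n n ℂ} (h : M.PosDef) : M * M⁻¹ = 1 :=
  Matrix.mul_nonsing_inv _ ((Matrix.isUnit_iff_isUnit_det _).1 h.isUnit)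

lemma PosDef.sandwich {M N : Matrix n n ℂ} (hM : M.PosDef) (hN : N.PosDef) :
    (N * M * N).PosDef := by
  have := (Matrix.IsUnit.posDef_star_right_conjugate_iff (U := N) (x := M) hN.isUnit).2 hM
  rwa [star_eq_conjTranspose, hN.isHermitian.eq] at this

lemma fid_core {a b : Matrix n n ℂ} (ha : a.PosDef) (hb : b.PosDef) :
    ∃ Y : Matrix n n ℂ, Y.PosDef ∧ Y * a * Y = b ∧ 0 ≤ (a * Y).trace.re ∧
      fid a b = ((a * Y).trace.re) ^ 2 := by
  obtain ⟨hs, hss⟩ := msqrt_posDef ha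
  set s := msqrt a with hsdef
  obtain ⟨hq, hqq⟩ := msqrt_posDef (PosDef.sandwich hb hs)
  set q := msqrt (s * b * s) with hqdef
  have i1 := PosDef.inv_mul hs
  have i2 := PosDef.mul_inv hs
  have htr : (a * (s⁻¹ * q * s⁻¹)).trace = q.trace := by
    rw [Matrix.trace_mul_comm, ← hss]
    have : s⁻¹ * q * s⁻¹ * (s * s) = s⁻¹ * q * ((s⁻¹ * s) * s) := by
      simp only [Matrix.mul_assoc]
    rw [this, i1, Matrix.one_mul, Matrix.trace_mul_comm, ← Matrix.mul_assoc, i2, Matrix.one_mul]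
  refine ⟨s⁻¹ * q * s⁻¹, PosDef.sandwich hq hs.inv, ?_, ?_, ?_⟩
  · calc s⁻¹ * q * s⁻¹ * a * (s⁻¹ * q * s⁻¹)
        = s⁻¹ * q * (s⁻¹ * s) * (s * s⁻¹) * q * s⁻¹ := by
          conv_lhs => rw [← hss]
          simp only [Matrix.mul_assoc]
      _ = s⁻¹ * (q * q) * s⁻¹ := by
          rw [i1, i2]; simp only [Matrix.mul_assoc, Matrix.mul_one, Matrix.one_mul]
      _ = (s⁻¹ * s) * b * (s * s⁻¹) := by rw [hqq]; simp only [Matrix.mul_assoc]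
      _ = b := by rw [i1, i2, Matrix.one_mul, Matrix.mul_one]
  · rw [htr]
    exact (Complex.le_def.1 hq.posSemidef.trace_nonneg).1
  · rw [htr]; rfl

lemma fid_le_one {a b : Matrix n n ℂ} (ha : a.PosDef) (hb : b.PosDef)
    (hta : a.trace = 1) (htb : b.trace = 1) :
    fid a b ≤ 1 ∧ (1 ≤ fid a b → b = a) := by
  obtain ⟨Y, hY, hYb, h0, hf⟩ := fid_core ha hb
  obtain ⟨hs, hss⟩ := msqrt_posDef ha
  set s := msqrt a
  have hYh := hY.isHermitian.eq
  have hsh := hs.isHermitian.eq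
  have e1 : ((Y * s - s)ᴴ * (Y * s - s)).trace = 2 - 2 * (a * Y).trace := by
    have : (Y * s - s)ᴴ * (Y * s - s) = s * (Y * Y) * s - s * Y * s - s * Y * s + s * s := by
      rw [conjTranspose_sub, conjTranspose_mul, hYh, hsh]
      noncomm_ring
    have t1 : (s * (Y * Y) * s).trace = 1 := by
      rw [Matrix.trace_mul_comm, ← Matrix.mul_assoc, hss, ← htb, ← hYb, ← Matrix.mul_assoc,
        Matrix.trace_mul_comm, ← Matrix.mul_assoc]
    have t2 : (s * Y * s).trace = (a * Y).trace := by
      rw [Matrix.trace_mul_comm, ← Matrix.mul_assoc, hss]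
    rw [this, trace_add, trace_sub, trace_sub, t1, t2, hss, hta]
    ring
  have e2 := trace_sq_nonneg (Y * s - s)
  have e3 : ((Y * s - s)ᴴ * (Y * s - s)).trace.re = 2 - 2 * (a * Y).trace.re := by
    rw [e1]; simp
  have hle : (a * Y).trace.re ≤ 1 := by linarith
  refine ⟨by rw [hf]; nlinarith, fun h1 => ?_⟩
  rw [hf] at h1
  have h2 : (a * Y).trace.re = 1 := by nlinarith
  have h3 : ((Y * s - s)ᴴ * (Y * s - s)).trace = 0 := by
    have hnn := (posSemidef_conjTranspose_mul_self (Y * s - s)).trace_nonneg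
    apply Complex.ext
    · rw [e3, h2]; simp
    · exact (Complex.le_def.1 hnn).2.symm
  rw [trace_conjTranspose_mul_self_eq_zero_iff, sub_eq_zero] at h3
  have h4 : Y = 1 := by
    have := congrArg (· * s⁻¹) h3
    simpa only [Matrix.mul_assoc, PosDef.mul_inv hs, Matrix.mul_one] using this
  rw [← hYb, h4, Matrix.one_mul, Matrix.mul_one]

variable {dS dB : ℕ}

lemma trace_ptraceB (M : Matrix (Fin dS × Fin dB) (Fin dS × Fin dB) ℂ) :
    (ptraceB M).trace = M.trace := by
  simp [ptraceB, Matrix.trace, Fintype.sum_prod_type]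

lemma trace_ptraceB_mul (M : Matrix (Fin dS × Fin dB) (Fin dS × Fin dB) ℂ)
    (Y : Matrix (Fin dS) (Fin dS) ℂ) :
    (ptraceB M * Y).trace = (M * (Y ⊗ₖ (1 : Matrix (Fin dB) (Fin dB) ℂ))).trace := by
  simp only [ptraceB, Matrix.trace, Matrix.diag, Matrix.mul_apply, Fintype.sum_prod_type,
    Matrix.of_apply, kronecker_apply, Matrix.one_apply, Finset.sum_mul]
  refine Finset.sum_congr rfl fun i _ => ?_
  rw [Finset.sum_comm]
  refine Finset.sum_congr rfl fun b _ => Finset.sum_congr rfl fun j _ => ?_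
  simp

lemma ptraceB_posDef [NeZero dB] {M : Matrix (Fin dS × Fin dB) (Fin dS × Fin dB) ℂ}
    (h : M.PosDef) : (ptraceB M).PosDef := by
  have : ptraceB M = ∑ b, M.submatrix (fun i => (i, b)) (fun i => (i, b)) := by
    ext i j
    simp [ptraceB, Matrix.sum_apply]
  rw [this]
  apply posDef_sum Finset.univ_nonempty
  intro b _
  exact h.submatrix (fun i j hij => by simpa using hij)

lemma fid_mono [NeZero dB] {A B : Matrix (Fin dS × Fin dB) (Fin dS × Fin dB) ℂ}
    (hA : A.PosDef) (hB : B.PosDef) (h0 : 0 ≤ (msqrt A * msqrt B).trace.re) :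
    ((msqrt A * msqrt B).trace.re) ^ 2 ≤ fid (ptraceB A) (ptraceB B) := by
  obtain ⟨Y, hY, hYb, hn, hf⟩ := fid_core (ptraceB_posDef hA) (ptraceB_posDef hB)
  rw [hf]
  refine pow_le_pow_left₀ h0 ?_ 2
  obtain ⟨hsA, hssA⟩ := msqrt_posDef hA
  obtain ⟨hsB, hssB⟩ := msqrt_posDef hB
  obtain ⟨hR, hRR⟩ := msqrt_posDef hY
  set s := msqrt A
  set t := msqrt B
  set R := msqrt Y
  set I : Matrix (Fin dB) (Fin dB) ℂ := 1 with hI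
  have hRI : (R ⊗ₖ I)ᴴ = R ⊗ₖ I := by
    rw [conjTranspose_kronecker, hR.isHermitian.eq, hI, conjTranspose_one]
  have hRI' : (R⁻¹ ⊗ₖ I)ᴴ = R⁻¹ ⊗ₖ I := by
    rw [conjTranspose_kronecker, hR.inv.isHermitian.eq, hI, conjTranspose_one]
  have m1 : (R ⊗ₖ I) * (R ⊗ₖ I) = Y ⊗ₖ I := by
    rw [← mul_kronecker_mul, hRR, hI, Matrix.mul_one]
  have m2 : (R⁻¹ ⊗ₖ I) * (R⁻¹ ⊗ₖ I) = Y⁻¹ ⊗ₖ I := by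
    rw [← mul_kronecker_mul, ← Matrix.mul_inv_rev, hRR, hI, Matrix.mul_one]
  have m3 : (R ⊗ₖ I) * (R⁻¹ ⊗ₖ I) = 1 := by
    rw [← mul_kronecker_mul, PosDef.mul_inv hR, hI, Matrix.mul_one, one_kronecker_one]
  have m4 : (R⁻¹ ⊗ₖ I) * (R ⊗ₖ I) = 1 := by
    rw [← mul_kronecker_mul, PosDef.inv_mul hR, hI, Matrix.mul_one, one_kronecker_one]
  have key := trace_sq_nonneg ((R ⊗ₖ I) * s - (R⁻¹ ⊗ₖ I) * t)
  have ex : ((R ⊗ₖ I) * s - (R⁻¹ ⊗ₖ I) * t)ᴴ * ((R ⊗ₖ I) * s - (R⁻¹ ⊗ₖ I) * t) =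
      s * (Y ⊗ₖ I) * s - s * t - t * s + t * (Y⁻¹ ⊗ₖ I) * t := by
    rw [conjTranspose_sub, conjTranspose_mul, conjTranspose_mul, hRI, hRI',
      hsA.isHermitian.eq, hsB.isHermitian.eq, ← m1, ← m2]
    calc _ = s * ((R ⊗ₖ I) * (R ⊗ₖ I)) * s - s * ((R ⊗ₖ I) * (R⁻¹ ⊗ₖ I)) * t
          - t * ((R⁻¹ ⊗ₖ I) * (R ⊗ₖ I)) * s + t * ((R⁻¹ ⊗ₖ I) * (R⁻¹ ⊗ₖ I)) * t := by
          noncomm_ring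
      _ = _ := by rw [m3, m4, Matrix.mul_one, Matrix.mul_one]
  have t1 : (s * (Y ⊗ₖ I) * s).trace = (ptraceB A * Y).trace := by
    rw [trace_ptraceB_mul, ← hssA, Matrix.trace_mul_comm, ← Matrix.mul_assoc]
  have t2 : (t * (Y⁻¹ ⊗ₖ I) * t).trace = (ptraceB A * Y).trace := by
    have : (t * (Y⁻¹ ⊗ₖ I) * t).trace = (ptraceB B * Y⁻¹).trace := by
      rw [trace_ptraceB_mul, ← hssB, Matrix.trace_mul_comm, ← Matrix.mul_assoc]
    rw [this, ← hYb, Matrix.mul_assoc, PosDef.mul_inv hY, Matrix.mul_one, Matrix.trace_mul_comm]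
  rw [ex, trace_add, trace_sub, trace_sub, t1, t2, Matrix.trace_mul_comm t s] at key
  simp only [Complex.add_re, Complex.sub_re] at key
  linarith

end fidelity

section calculus
variable {n m : Type} [Fintype n] [DecidableEq n] [Fintype m] [DecidableEq m]

lemma mfun_conj {M U : Matrix n n ℂ} (hM : M.IsHermitian) (h1 : U * Uᴴ = 1) (h2 : Uᴴ * U = 1)
    (f : ℝ → ℂ) : mfun f (U * M * Uᴴ) = U * mfun f M * Uᴴ := by
  obtain ⟨V, d, hV⟩ := exists_Dg hM
  rw [(hV.conj h1 h2).mfun, hV.mfun, conjTranspose_mul]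
  simp only [Matrix.mul_assoc]

lemma msqrt_kron {A : Matrix n n ℂ} {B : Matrix m m ℂ} (hA : A.PosDef) (hB : B.PosDef) :
    msqrt (A ⊗ₖ B) = msqrt A ⊗ₖ msqrt B := by
  obtain ⟨V, a, hV, ha⟩ := exists_Dg_pos hA
  obtain ⟨W, b, hW, hb⟩ := exists_Dg_pos hB
  have hsA : Dg (msqrt A) V (fun i => Real.sqrt (a i)) := hV.mfunR (fun i => rfl)
  have hsB : Dg (msqrt B) W (fun i => Real.sqrt (b i)) := hW.mfunR (fun i => rfl)
  have h : Dg (msqrt (A ⊗ₖ B)) (V ⊗ₖ W) (fun p => Real.sqrt (a p.1 * b p.2)) :=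
    (hV.kron hW).mfunR (fun i => rfl)
  exact h.eq (hsA.kron hsB) (fun p => Real.sqrt_mul (ha _).le _)

lemma mlog_kron {A : Matrix n n ℂ} {B : Matrix m m ℂ} (hA : A.PosDef) (hB : B.PosDef) :
    mlog (A ⊗ₖ B) = mlog A ⊗ₖ (1 : Matrix m m ℂ) + (1 : Matrix n n ℂ) ⊗ₖ mlog B := by
  obtain ⟨V, a, hV, ha⟩ := exists_Dg_pos hA
  obtain ⟨W, b, hW, hb⟩ := exists_Dg_pos hB
  have hsA : Dg (mlog A) V (fun i => Real.log (a i)) := hV.mfunR (fun i => rfl)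
  have hsB : Dg (mlog B) W (fun i => Real.log (b i)) := hW.mfunR (fun i => rfl)
  have h : Dg (mlog (A ⊗ₖ B)) (V ⊗ₖ W) (fun p => Real.log (a p.1 * b p.2)) :=
    (hV.kron hW).mfunR (fun i => rfl)
  exact h.eq (hsA.kron_add hsB) (fun p => Real.log_mul (ha _).ne' (hb _).ne')

lemma mpow_half {A : Matrix n n ℂ} (hA : A.PosDef) : mpow A (1/2) = msqrt A := by
  obtain ⟨V, a, hV, ha⟩ := exists_Dg_pos hA
  have h1 : Dg (msqrt A) V (fun i => Real.sqrt (a i)) := hV.mfunR (fun i => rfl)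
  refine Dg.eq (hV.mfunR (g := fun i => a i ^ (1/2 : ℝ)) (fun i => ?_)) h1
    (fun i => (Real.sqrt_eq_rpow (a i)).symm)
  rw [Complex.ofReal_cpow (ha i).le]; norm_num

lemma mpow_neg_half {A : Matrix n n ℂ} (hA : A.PosDef) : mpow A (-(1/2)) = (msqrt A)⁻¹ := by
  obtain ⟨V, a, hV, ha⟩ := exists_Dg_pos hA
  have h1 : Dg (msqrt A) V (fun i => Real.sqrt (a i)) := hV.mfunR (fun i => rfl)
  have h2 : Dg (mpow A (-(1/2))) V (fun i => a i ^ (-(1/2) : ℝ)) := hV.mfunR (fun i => by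
    rw [Complex.ofReal_cpow (ha i).le]; norm_num)
  symm
  apply Matrix.inv_eq_right_inv
  rw [h1.2.2, h2.2.2]
  calc _ = V * (diagonal (fun i => (Real.sqrt (a i) : ℂ)) * (Vᴴ * V) *
        diagonal (fun i => ((a i ^ (-(1/2) : ℝ) : ℝ) : ℂ))) * Vᴴ := by
        simp only [Matrix.mul_assoc]
    _ = V * 1 * Vᴴ := by
      rw [hV.2.1, Matrix.mul_one, diagonal_mul_diagonal]
      congr 2
      rw [← diagonal_one]
      congr 1
      ext i
      rw [← Complex.ofReal_mul, Real.sqrt_eq_rpow, ← Real.rpow_add (ha i)]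
      norm_num
    _ = 1 := by rw [Matrix.mul_one, hV.1]

lemma Dg.mexpNeg {H V : Matrix n n ℂ} {d : n → ℝ} (h : Dg H V d) (β : ℝ) :
    Dg (mexpNeg β H) V (fun i => Real.exp (-β * d i)) := h.mfunR (fun i => rfl)

lemma trace_mexpNeg {H : Matrix n n ℂ} (hH : H.IsHermitian) (β : ℝ) :
    (mexpNeg β H).trace = (partZ β H : ℂ) := by
  obtain ⟨V, d, hV⟩ := exists_Dg hH
  unfold partZ
  rw [(hV.mexpNeg β).trace, Complex.ofReal_re]

lemma partZ_pos [Nonempty n] {H : Matrix n n ℂ} (hH : H.IsHermitian) (β : ℝ) :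
    0 < partZ β H := by
  obtain ⟨V, d, hV⟩ := exists_Dg hH
  unfold partZ
  rw [(hV.mexpNeg β).trace, Complex.ofReal_re]
  exact Finset.sum_pos (fun i _ => Real.exp_pos _) Finset.univ_nonempty

lemma gibbs_eq {H : Matrix n n ℂ} (hH : H.IsHermitian) (β : ℝ) :
    gibbs β H = (((partZ β H)⁻¹ : ℝ) : ℂ) • mexpNeg β H := by
  unfold gibbs
  rw [trace_mexpNeg hH, Complex.ofReal_inv]

lemma gibbs_posDef [Nonempty n] {H : Matrix n n ℂ} (hH : H.IsHermitian) (β : ℝ) :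
    (gibbs β H).PosDef := by
  obtain ⟨V, d, hV⟩ := exists_Dg hH
  rw [gibbs_eq hH]
  exact ((hV.mexpNeg β).smul _).posDef
    (fun i => mul_pos (inv_pos.2 (partZ_pos hH β)) (Real.exp_pos _))

lemma gibbs_trace [Nonempty n] {H : Matrix n n ℂ} (hH : H.IsHermitian) (β : ℝ) :
    (gibbs β H).trace = 1 := by
  rw [gibbs_eq hH, trace_smul, trace_mexpNeg hH, smul_eq_mul, ← Complex.ofReal_mul,
    inv_mul_cancel₀ (partZ_pos hH β).ne']
  simp

lemma mlog_gibbs [Nonempty n] {H : Matrix n n ℂ} (hH : H.IsHermitian) (β : ℝ) :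
    mlog (gibbs β H) = ((-β : ℝ) : ℂ) • H + ((-Real.log (partZ β H) : ℝ) : ℂ) • 1 := by
  obtain ⟨V, d, hV⟩ := exists_Dg hH
  rw [gibbs_eq hH]
  have h1 : Dg (mlog ((((partZ β H)⁻¹ : ℝ) : ℂ) • _root_.mexpNeg β H)) V
      (fun i => Real.log ((partZ β H)⁻¹ * Real.exp (-β * d i))) :=
    ((hV.mexpNeg β).smul _).mfunR (fun i => rfl)
  refine h1.eq (hV.one_add _ _) (fun i => ?_)
  rw [Real.log_mul (inv_pos.2 (partZ_pos hH β)).ne' (Real.exp_pos _).ne', Real.log_exp,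
    Real.log_inv]
  ring

lemma mexpNeg_kron {A : Matrix n n ℂ} {B : Matrix m m ℂ} (hA : A.IsHermitian)
    (hB : B.IsHermitian) (β : ℝ) :
    mexpNeg β (A ⊗ₖ (1 : Matrix m m ℂ) + (1 : Matrix n n ℂ) ⊗ₖ B) =
      mexpNeg β A ⊗ₖ mexpNeg β B := by
  obtain ⟨V, a, hV⟩ := exists_Dg hA
  obtain ⟨W, b, hW⟩ := exists_Dg hB
  refine ((hV.kron_add hW).mexpNeg β).eq ((hV.mexpNeg β).kron (hW.mexpNeg β)) (fun p => ?_)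
  rw [← Real.exp_add]; ring_nf

lemma kron_add_herm {A : Matrix n n ℂ} {B : Matrix m m ℂ} (hA : A.IsHermitian)
    (hB : B.IsHermitian) :
    (A ⊗ₖ (1 : Matrix m m ℂ) + (1 : Matrix n n ℂ) ⊗ₖ B).IsHermitian := by
  obtain ⟨V, a, hV⟩ := exists_Dg hA
  obtain ⟨W, b, hW⟩ := exists_Dg hB
  exact (hV.kron_add hW).herm

end calculus

/-- The hypotheses on Hamiltonians and the unitary. -/
structure Setup {dS dB : ℕ} (HS HS' : Matrix (Fin dS) (Fin dS) ℂ)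
    (HB HB' : Matrix (Fin dB) (Fin dB) ℂ)
    (U : Matrix (Fin dS × Fin dB) (Fin dS × Fin dB) ℂ) : Prop where
  hHS : HS.IsHermitian
  hHS' : HS'.IsHermitian
  hHB : HB.IsHermitian
  hHB' : HB'.IsHermitian
  hU : U * Uᴴ = 1
  hU' : Uᴴ * U = 1
  hcons : U * (HS ⊗ₖ (1 : Matrix (Fin dB) (Fin dB) ℂ) +
        (1 : Matrix (Fin dS) (Fin dS) ℂ) ⊗ₖ HB) * Uᴴ =
      HS' ⊗ₖ (1 : Matrix (Fin dB) (Fin dB) ℂ) + (1 : Matrix (Fin dS) (Fin dS) ℂ) ⊗ₖ HB'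

namespace Setup
variable {dS dB : ℕ} {HS HS' : Matrix (Fin dS) (Fin dS) ℂ}
    {HB HB' : Matrix (Fin dB) (Fin dB) ℂ}
    {U : Matrix (Fin dS × Fin dB) (Fin dS × Fin dB) ℂ}

lemma unconj (h : Setup HS HS' HB HB' U)
    (M : Matrix (Fin dS × Fin dB) (Fin dS × Fin dB) ℂ) : Uᴴ * (U * M * Uᴴ) * U = M := by
  calc _ = (Uᴴ * U) * M * (Uᴴ * U) := by simp only [Matrix.mul_assoc]
    _ = M := by rw [h.hU', Matrix.one_mul, Matrix.mul_one]

lemma symm (h : Setup HS HS' HB HB' U) : Setup HS' HS HB' HB Uᴴ where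
  hHS := h.hHS'
  hHS' := h.hHS
  hHB := h.hHB'
  hHB' := h.hHB
  hU := by rw [conjTranspose_conjTranspose, h.hU']
  hU' := by rw [conjTranspose_conjTranspose, h.hU]
  hcons := by rw [conjTranspose_conjTranspose, ← h.hcons, h.unconj]

lemma exp_conj (h : Setup HS HS' HB HB' U) (β : ℝ) :
    U * (mexpNeg β HS ⊗ₖ mexpNeg β HB) * Uᴴ = mexpNeg β HS' ⊗ₖ mexpNeg β HB' := by
  rw [← mexpNeg_kron h.hHS h.hHB, ← mexpNeg_kron h.hHS' h.hHB', ← h.hcons]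
  exact (mfun_conj (kron_add_herm h.hHS h.hHB) h.hU h.hU' _).symm

lemma trace_conj (h : Setup HS HS' HB HB' U)
    (M : Matrix (Fin dS × Fin dB) (Fin dS × Fin dB) ℂ) : (U * M * Uᴴ).trace = M.trace := by
  rw [Matrix.trace_mul_comm, ← Matrix.mul_assoc, h.hU', Matrix.one_mul]

lemma partZ_mul (h : Setup HS HS' HB HB' U) (β : ℝ) :
    partZ β HS * partZ β HB = partZ β HS' * partZ β HB' := by
  have := congrArg Matrix.trace (h.exp_conj β)
  rw [h.trace_conj, trace_kronecker, trace_kronecker, trace_mexpNeg h.hHS,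
    trace_mexpNeg h.hHB, trace_mexpNeg h.hHS', trace_mexpNeg h.hHB'] at this
  exact_mod_cast this

lemma gibbs_conj (h : Setup HS HS' HB HB' U) (β : ℝ) :
    U * (gibbs β HS ⊗ₖ gibbs β HB) * Uᴴ = gibbs β HS' ⊗ₖ gibbs β HB' := by
  rw [gibbs_eq h.hHS, gibbs_eq h.hHB, gibbs_eq h.hHS', gibbs_eq h.hHB',
    smul_kronecker, kronecker_smul, smul_kronecker, kronecker_smul, smul_smul, smul_smul,
    Matrix.mul_smul, Matrix.smul_mul, h.exp_conj, ← Complex.ofReal_mul, ← Complex.ofReal_mul,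
    ← mul_inv, ← mul_inv, h.partZ_mul]

lemma ptraceB_kron (A : Matrix (Fin dS) (Fin dS) ℂ) (B : Matrix (Fin dB) (Fin dB) ℂ) :
    ptraceB (A ⊗ₖ B) = B.trace • A := by
  ext i j
  simp [ptraceB, Matrix.trace, ← Finset.mul_sum, mul_comm]

lemma channel_gibbs [NeZero dB] (h : Setup HS HS' HB HB' U) (β : ℝ) :
    thChannel U (gibbs β HB) (gibbs β HS) = gibbs β HS' := by
  unfold thChannel
  rw [h.gibbs_conj, ptraceB_kron, gibbs_trace h.hHB', one_smul]

lemma petz_eq [NeZero dS] [NeZero dB] (h : Setup HS HS' HB HB' U) (β : ℝ)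
    (Nadj : Matrix (Fin dS) (Fin dS) ℂ → Matrix (Fin dS) (Fin dS) ℂ)
    (hNadj : ∀ X Y : Matrix (Fin dS) (Fin dS) ℂ,
      (Xᴴ * thChannel U (gibbs β HB) Y).trace = ((Nadj X)ᴴ * Y).trace)
    {ω : Matrix (Fin dS) (Fin dS) ℂ} (hω : ω.IsHermitian) :
    petzOf Nadj (gibbs β HS) (gibbs β HS') ω = thChannel Uᴴ (gibbs β HB') ω := by
  have hγ := gibbs_posDef h.hHS β
  have hγ' := gibbs_posDef h.hHS' β
  have hB := gibbs_posDef h.hHB β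
  have hB' := gibbs_posDef h.hHB' β
  have hconj := h.gibbs_conj β
  unfold petzOf
  rw [mpow_half hγ, mpow_neg_half hγ']
  set γ := gibbs β HS
  set γ' := gibbs β HS'
  set γB := gibbs β HB
  set γB' := gibbs β HB'
  have hsq : U * (msqrt γ ⊗ₖ msqrt γB) * Uᴴ = msqrt γ' ⊗ₖ msqrt γB' := by
    rw [← msqrt_kron hγ hB, ← msqrt_kron hγ' hB', ← hconj]
    exact (mfun_conj (hγ.kronecker hB).isHermitian h.hU h.hU' _).symm
  obtain ⟨pG, sG⟩ := msqrt_posDef hγ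
  obtain ⟨pG', sG'⟩ := msqrt_posDef hγ'
  obtain ⟨pB, sB⟩ := msqrt_posDef hB
  obtain ⟨pB', sB'⟩ := msqrt_posDef hB'
  set G := msqrt γ
  set G' := msqrt γ'
  set gB := msqrt γB
  set gB' := msqrt γB'
  have hX : (G'⁻¹ * ω * G'⁻¹)ᴴ = G'⁻¹ * ω * G'⁻¹ := by
    rw [conjTranspose_mul, conjTranspose_mul, pG'.inv.isHermitian.eq, hω.eq, Matrix.mul_assoc]
  set X := G'⁻¹ * ω * G'⁻¹ with hXdef
  have hGX : G' * X * G' = ω := by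
    rw [hXdef]
    calc _ = (G' * G'⁻¹) * ω * (G'⁻¹ * G') := by simp only [Matrix.mul_assoc]
      _ = ω := by rw [PosDef.mul_inv pG', PosDef.inv_mul pG', Matrix.one_mul, Matrix.mul_one]
  -- it suffices to compare adjoints, tested against all matrices
  have main : ∀ Z : Matrix (Fin dS) (Fin dS) ℂ,
      ((G * Nadj X * G)ᴴ * Z).trace = (thChannel Uᴴ γB' ω * Z).trace := by
    intro Z
    have e1 : ((G * Nadj X * G)ᴴ * Z).trace = ((Nadj X)ᴴ * (G * Z * G)).trace := by
      rw [conjTranspose_mul, conjTranspose_mul, pG.isHermitian.eq, Matrix.mul_assoc,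
        Matrix.trace_mul_comm]
      simp only [Matrix.mul_assoc]
    rw [e1, ← hNadj, hX, Matrix.trace_mul_comm]
    unfold thChannel
    rw [trace_ptraceB_mul, trace_ptraceB_mul, conjTranspose_conjTranspose]
    have k1 : (G * Z * G) ⊗ₖ γB =
        (G ⊗ₖ gB) * (Z ⊗ₖ (1 : Matrix (Fin dB) (Fin dB) ℂ)) * (G ⊗ₖ gB) := by
      rw [← mul_kronecker_mul, ← mul_kronecker_mul, Matrix.mul_one, sB]
    have k2 : ω ⊗ₖ γB' =
        (G' ⊗ₖ gB') * (X ⊗ₖ (1 : Matrix (Fin dB) (Fin dB) ℂ)) * (G' ⊗ₖ gB') := by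
      rw [← mul_kronecker_mul, ← mul_kronecker_mul, Matrix.mul_one, sB', hGX]
    rw [k1, k2, ← hsq]
    generalize G ⊗ₖ gB = P
    generalize Z ⊗ₖ (1 : Matrix (Fin dB) (Fin dB) ℂ) = Z1
    generalize X ⊗ₖ (1 : Matrix (Fin dB) (Fin dB) ℂ) = X1
    calc (U * (P * Z1 * P) * Uᴴ * X1).trace
        = ((U * P * Z1) * (P * Uᴴ * X1)).trace := by simp only [Matrix.mul_assoc]
      _ = ((P * Uᴴ * X1) * (U * P * Z1)).trace := Matrix.trace_mul_comm _ _
      _ = (((Uᴴ * U) * P * Uᴴ * X1 * U * P * (Uᴴ * U)) * Z1).trace := by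
          rw [h.hU']; simp only [Matrix.mul_assoc, Matrix.one_mul]
      _ = _ := by simp only [Matrix.mul_assoc]
  have e : (G * Nadj X * G)ᴴ = thChannel Uᴴ γB' ω :=
    Matrix.ext_iff_trace_mul_right.2 main
  have hh : (thChannel Uᴴ γB' ω)ᴴ = thChannel Uᴴ γB' ω := by
    have : (Uᴴ * (ω ⊗ₖ γB') * Uᴴᴴ)ᴴ = Uᴴ * (ω ⊗ₖ γB') * Uᴴᴴ := by
      rw [conjTranspose_mul, conjTranspose_mul, conjTranspose_kronecker, hω.eq,
        hB'.isHermitian.eq, conjTranspose_conjTranspose, Matrix.mul_assoc]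
    ext i j
    simp only [thChannel, ptraceB, conjTranspose_apply, Matrix.of_apply, star_sum]
    refine Finset.sum_congr rfl fun b _ => ?_
    conv_rhs => rw [← this, conjTranspose_apply]
  rw [← conjTranspose_conjTranspose (G * Nadj X * G), e, hh]

end Setup

namespace Setup
variable {dS dB : ℕ} {HS HS' : Matrix (Fin dS) (Fin dS) ℂ}
    {HB HB' : Matrix (Fin dB) (Fin dB) ℂ}
    {U : Matrix (Fin dS × Fin dB) (Fin dS × Fin dB) ℂ}

/-- the chain rule for the relative entropy of the joint output -/
lemma entropy [NeZero dS] [NeZero dB] (h : Setup HS HS' HB HB' U) {β : ℝ} (hβ : 0 < β)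
    {ρ : Matrix (Fin dS) (Fin dS) ℂ} (hρ : ρ.PosDef) (htr : ρ.trace = 1)
    (hN : (thChannel U (gibbs β HB) ρ).PosDef) :
    ((ρ ⊗ₖ gibbs β HB) *
      mlog (Uᴴ * (thChannel U (gibbs β HB) ρ ⊗ₖ gibbs β HB') * U)).trace.re -
    ((ρ ⊗ₖ gibbs β HB) * mlog (ρ ⊗ₖ gibbs β HB)).trace.re =
    β * ((freeEnergy β (thChannel U (gibbs β HB) ρ) HS' - freeEnergy β ρ HS) -
      β⁻¹ * Real.log (partZ β HS / partZ β HS')) := by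
  have hB := gibbs_posDef h.hHB β
  have hB' := gibbs_posDef h.hHB' β
  have tB := gibbs_trace h.hHB β
  have lB := mlog_gibbs h.hHB β
  have lB' := mlog_gibbs h.hHB' β
  have hZ := h.partZ_mul β
  have z1 := partZ_pos h.hHS β
  have z2 := partZ_pos h.hHS' β
  have z3 := partZ_pos h.hHB β
  have z4 := partZ_pos h.hHB' β
  set ω := thChannel U (gibbs β HB) ρ with hω
  set γB := gibbs β HB
  set γB' := gibbs β HB'
  set σ := U * (ρ ⊗ₖ γB) * Uᴴ with hσ
  have hωσ : ω = ptraceB σ := rfl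
  have tσ : σ.trace = 1 := by rw [hσ, h.trace_conj, trace_kronecker, htr, tB, one_mul]
  -- first term
  have a1 : ((ρ ⊗ₖ γB) * mlog (Uᴴ * (ω ⊗ₖ γB') * U)).trace =
      (ω * mlog ω).trace - β * (σ * ((1 : Matrix (Fin dS) (Fin dS) ℂ) ⊗ₖ HB')).trace
        - Real.log (partZ β HB') := by
    have c1 : mlog (Uᴴ * (ω ⊗ₖ γB') * U) = Uᴴ * mlog (ω ⊗ₖ γB') * U := by
      have := mfun_conj (U := Uᴴ) (hN.kronecker hB').isHermitian h.symm.hU h.symm.hU'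
        (fun r => (Real.log r : ℂ))
      rwa [conjTranspose_conjTranspose] at this
    have c2 : ((ρ ⊗ₖ γB) * (Uᴴ * mlog (ω ⊗ₖ γB') * U)).trace = (σ * mlog (ω ⊗ₖ γB')).trace := by
      rw [hσ, ← Matrix.mul_assoc, Matrix.trace_mul_comm]
      simp only [Matrix.mul_assoc]
    rw [c1, c2, mlog_kron hN hB', Matrix.mul_add, trace_add, ← trace_ptraceB_mul, ← hωσ, lB',
      kronecker_add, kronecker_smul, kronecker_smul, one_kronecker_one, Matrix.mul_add,
      Matrix.mul_smul, Matrix.mul_smul, Matrix.mul_one, trace_add, trace_smul, trace_smul, tσ]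
    push_cast
    simp only [smul_eq_mul]
    ring
  have a2 : ((ρ ⊗ₖ γB) * mlog (ρ ⊗ₖ γB)).trace =
      (ρ * mlog ρ).trace - β * (γB * HB).trace - Real.log (partZ β HB) := by
    rw [mlog_kron hρ hB, Matrix.mul_add, trace_add, ← mul_kronecker_mul, ← mul_kronecker_mul,
      trace_kronecker, trace_kronecker, Matrix.mul_one, Matrix.mul_one, htr, tB, lB,
      Matrix.mul_add, Matrix.mul_smul, Matrix.mul_smul, Matrix.mul_one, trace_add, trace_smul,
      trace_smul, tB]
    push_cast
    simp only [smul_eq_mul]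
    ring
  have a3 : (ω * HS').trace + (σ * ((1 : Matrix (Fin dS) (Fin dS) ℂ) ⊗ₖ HB')).trace =
      (ρ * HS).trace + (γB * HB).trace := by
    rw [hωσ, trace_ptraceB_mul, ← trace_add, ← Matrix.mul_add, ← h.hcons, hσ]
    have : U * (ρ ⊗ₖ γB) * Uᴴ * (U * (HS ⊗ₖ (1 : Matrix (Fin dB) (Fin dB) ℂ) +
        (1 : Matrix (Fin dS) (Fin dS) ℂ) ⊗ₖ HB) * Uᴴ) =
        U * ((ρ ⊗ₖ γB) * ((Uᴴ * U) * (HS ⊗ₖ (1 : Matrix (Fin dB) (Fin dB) ℂ) +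
        (1 : Matrix (Fin dS) (Fin dS) ℂ) ⊗ₖ HB))) * Uᴴ := by
      simp only [Matrix.mul_assoc]
    rw [this, h.trace_conj, h.hU', Matrix.one_mul, Matrix.mul_add, trace_add,
      ← mul_kronecker_mul, ← mul_kronecker_mul, trace_kronecker, trace_kronecker,
      Matrix.mul_one, Matrix.mul_one, htr, tB, one_mul, mul_one]
  have a4 := congrArg Complex.re a3
  have lz : Real.log (partZ β HS / partZ β HS') =
      Real.log (partZ β HB') - Real.log (partZ β HB) := by
    rw [← Real.log_div z4.ne' z3.ne']
    congr 1
    rw [div_eq_div_iff z2.ne' z3.ne', hZ]; ring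
  rw [a1, a2, lz]
  unfold freeEnergy vonNeumann
  simp only [Complex.add_re, Complex.sub_re, Complex.ofReal_re, Complex.re_ofReal_mul] at a4 ⊢
  field_simp
  linear_combination (-β) * a4

lemma bound [NeZero dS] [NeZero dB] (h : Setup HS HS' HB HB' U) {β : ℝ} (hβ : 0 < β)
    {ρ : Matrix (Fin dS) (Fin dS) ℂ} (hρ : ρ.PosDef) (htr : ρ.trace = 1)
    (hN : (thChannel U (gibbs β HB) ρ).PosDef) :
    Real.exp (β * ((freeEnergy β (thChannel U (gibbs β HB) ρ) HS' - freeEnergy β ρ HS) -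
      β⁻¹ * Real.log (partZ β HS / partZ β HS'))) ≤
      fid ρ (thChannel Uᴴ (gibbs β HB') (thChannel U (gibbs β HB) ρ)) ∧
    (thChannel Uᴴ (gibbs β HB') (thChannel U (gibbs β HB) ρ)).PosDef ∧
    (thChannel U (gibbs β HB) ρ).trace = 1 ∧
    (thChannel Uᴴ (gibbs β HB') (thChannel U (gibbs β HB) ρ)).trace = 1 := by
  have hent := h.entropy hβ hρ htr hN
  have hB := gibbs_posDef h.hHB β
  have hB' := gibbs_posDef h.hHB' β
  have tB := gibbs_trace h.hHB β
  have tB' := gibbs_trace h.hHB' β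
  have tω : (thChannel U (gibbs β HB) ρ).trace = 1 := by
    unfold thChannel
    rw [trace_ptraceB, h.trace_conj, trace_kronecker, htr, tB, one_mul]
  rw [← hent]
  set ω := thChannel U (gibbs β HB) ρ with hω
  have hR : thChannel Uᴴ (gibbs β HB') ω = ptraceB (Uᴴ * (ω ⊗ₖ gibbs β HB') * U) := by
    unfold thChannel; rw [conjTranspose_conjTranspose]
  have pA := hρ.kronecker hB
  have pB : (Uᴴ * (ω ⊗ₖ gibbs β HB') * U).PosDef := by
    have hUu : IsUnit U := ⟨⟨U, Uᴴ, h.hU, h.hU'⟩, rfl⟩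
    exact (Matrix.IsUnit.posDef_star_left_conjugate_iff (U := U) hUu).2 (hN.kronecker hB')
  have tR : (thChannel Uᴴ (gibbs β HB') ω).trace = 1 := by
    unfold thChannel
    rw [trace_ptraceB, h.symm.trace_conj, trace_kronecker, tω, tB', one_mul]
  refine ⟨?_, hR ▸ ptraceB_posDef pB, tω, tR⟩
  have hρp : ρ = ptraceB (ρ ⊗ₖ gibbs β HB) := by rw [ptraceB_kron, tB, one_smul]
  have hj := jensen pA pB (by rw [trace_kronecker, htr, tB, one_mul])
  have hm := fid_mono pA pB ((Real.exp_pos _).le.trans hj)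
  rw [← hρp, ← hR] at hm
  refine le_trans ?_ hm
  refine le_trans (le_of_eq ?_) (pow_le_pow_left₀ (Real.exp_pos _).le hj 2)
  rw [← Real.exp_nat_mul]
  congr 1
  push_cast
  ring

lemma le [NeZero dS] [NeZero dB] (h : Setup HS HS' HB HB' U) {β : ℝ} (hβ : 0 < β)
    {ρ : Matrix (Fin dS) (Fin dS) ℂ} (hρ : ρ.PosDef) (htr : ρ.trace = 1)
    (hN : (thChannel U (gibbs β HB) ρ).PosDef) :
    freeEnergy β (thChannel U (gibbs β HB) ρ) HS' - freeEnergy β ρ HS ≤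
      β⁻¹ * Real.log (partZ β HS / partZ β HS') := by
  obtain ⟨b1, b2, b3, b4⟩ := h.bound hβ hρ htr hN
  have := b1.trans (fid_le_one hρ b2 htr b4).1
  rw [Real.exp_le_one_iff] at this
  by_contra hc
  push Not at hc
  have := mul_pos hβ (sub_pos.2 hc)
  linarith

end Setup

/-- recovery of thermodynamic channels — ΔF ≤ ΔF_eq, the recovery fidelity
obeys F(ρ, R_{γ_S}(N_th(ρ))) ≥ e^{β(ΔF − ΔF_eq)}, and ρ is fully recovered by the Petz
recovery map iff ΔF = ΔF_eq. -/
theorem recovery_of_thermodynamic_channels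
    {dS dB : ℕ}
    (HS HS' : Matrix (Fin dS) (Fin dS) ℂ) (hHS : HS.IsHermitian) (hHS' : HS'.IsHermitian)
    (HB HB' : Matrix (Fin dB) (Fin dB) ℂ) (hHB : HB.IsHermitian) (hHB' : HB'.IsHermitian)
    (β : ℝ) (hβ : 0 < β)
    (U : Matrix (Fin dS × Fin dB) (Fin dS × Fin dB) ℂ)
    (hU : U * Uᴴ = 1) (hU' : Uᴴ * U = 1)
    (hcons : U * (HS ⊗ₖ (1 : Matrix (Fin dB) (Fin dB) ℂ) +
        (1 : Matrix (Fin dS) (Fin dS) ℂ) ⊗ₖ HB) * Uᴴ =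
      HS' ⊗ₖ (1 : Matrix (Fin dB) (Fin dB) ℂ) + (1 : Matrix (Fin dS) (Fin dS) ℂ) ⊗ₖ HB')
    (Nadj : Matrix (Fin dS) (Fin dS) ℂ → Matrix (Fin dS) (Fin dS) ℂ)
    (hNadj : ∀ X Y : Matrix (Fin dS) (Fin dS) ℂ,
      (Xᴴ * thChannel U (gibbs β HB) Y).trace = ((Nadj X)ᴴ * Y).trace)
    (ρ : Matrix (Fin dS) (Fin dS) ℂ) (hρ : ρ.PosDef) (hρtr : ρ.trace = 1)
    (hNρ : (thChannel U (gibbs β HB) ρ).PosDef) :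
    ∀ ΔF ΔFeq : ℝ,
      ΔF = freeEnergy β (thChannel U (gibbs β HB) ρ) HS' - freeEnergy β ρ HS →
      ΔFeq = β⁻¹ * Real.log (partZ β HS / partZ β HS') →
      ΔF ≤ ΔFeq ∧
      fid ρ (petzOf Nadj (gibbs β HS) (thChannel U (gibbs β HB) (gibbs β HS))
          (thChannel U (gibbs β HB) ρ)) ≥ Real.exp (β * (ΔF - ΔFeq)) ∧
      (petzOf Nadj (gibbs β HS) (thChannel U (gibbs β HB) (gibbs β HS))
          (thChannel U (gibbs β HB) ρ) = ρ ↔ ΔF = ΔFeq) := by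
  intro ΔF ΔFeq hΔF hΔFeq
  have st : Setup HS HS' HB HB' U := ⟨hHS, hHS', hHB, hHB', hU, hU', hcons⟩
  have : NeZero dS := ⟨by
    rintro rfl
    simp [Matrix.trace] at hρtr⟩
  have : NeZero dB := ⟨by
    rintro rfl
    have := hNρ.trace_pos
    unfold thChannel at this
    rw [trace_ptraceB] at this
    simp [Matrix.trace] at this⟩
  obtain ⟨b1, b2, b3, b4⟩ := st.bound hβ hρ hρtr hNρ
  have hle := st.le hβ hρ hρtr hNρ
  rw [st.channel_gibbs, st.petz_eq β Nadj hNadj hNρ.isHermitian]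
  rw [← hΔF, ← hΔFeq] at hle b1
  refine ⟨hle, b1, fun hrec => le_antisymm hle ?_, fun heq => ?_⟩
  · have h2 := st.symm.le hβ hNρ b3 (by rw [hrec]; exact hρ)
    rw [hrec] at h2
    have hlog : Real.log (partZ β HS' / partZ β HS) = -Real.log (partZ β HS / partZ β HS') := by
      rw [← Real.log_inv, inv_div]
    rw [hlog, mul_neg, ← hΔFeq] at h2
    linarith
  · rw [heq, sub_self, mul_zero, Real.exp_zero] at b1
    exact (fid_le_one hρ b2 hρtr b4).2 b1
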